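/- Let s ∈ (1/2,1) and set c_{N,s} = ( ∫_{ℝ^{N-1}} |y'|² P_s((y',0)) dy' ) / ( 2 ∫_{ℝ^{N-1}} P_s((y',0)) dy' ). Then there exist constants C > 0 and t₀ > 0 such that for all t ∈ (0, t₀) and all v ∈ ℝ satisfying |v t| ≤ t^{1/2} and u(v t e_N, t^s) = 0, one has |v − c_{N,s} H(0)| ≤ C t^{(2s−1)/2}. -/

import Mathlib

open MeasureTheory Metric Real Set

noncomputable section

/-- Append a last coordinate: `(y', a) ∈ ℝ^{N-1} × ℝ ↦ ℝ^N`. -/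
def snocPt {d : ℕ} (y' : EuclideanSpace ℝ (Fin d)) (a : ℝ) :
    EuclideanSpace ℝ (Fin (d + 1)) :=
  (EuclideanSpace.equiv (Fin (d + 1)) ℝ).symm
    (Fin.snoc ((EuclideanSpace.equiv (Fin d) ℝ) y') a)

/-- The last standard basis vector `e_N` of `ℝ^N`. -/
def eN (d : ℕ) : EuclideanSpace ℝ (Fin (d + 1)) :=
  EuclideanSpace.single (Fin.last d) 1

/-- `τ_E = 𝟙_E − 𝟙_{ℝ^N ∖ cl E}`. -/
def tauE {d : ℕ} (E : Set (EuclideanSpace ℝ (Fin (d + 1))))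
    (y : EuclideanSpace ℝ (Fin (d + 1))) : ℝ :=
  Set.indicator E (fun _ => 1) y - Set.indicator (closure E)ᶜ (fun _ => 1) y

/-- The kernel `𝒦_s(x,t) = t^{-N/(2s)} P_s(t^{-1/(2s)} x)` with `N = d+1`. -/
def ker {d : ℕ} (s : ℝ) (P : EuclideanSpace ℝ (Fin (d + 1)) → ℝ)
    (x : EuclideanSpace ℝ (Fin (d + 1))) (t : ℝ) : ℝ :=
  t ^ (-(((d : ℝ) + 1) / (2 * s))) * P ((t ^ (-(1 : ℝ) / (2 * s))) • x)

/-- `u(x,t) = ∫_{ℝ^N} 𝒦_s(x−y,t) τ_E(y) dy`. -/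
def uF {d : ℕ} (s : ℝ) (P : EuclideanSpace ℝ (Fin (d + 1)) → ℝ)
    (E : Set (EuclideanSpace ℝ (Fin (d + 1)))) (x : EuclideanSpace ℝ (Fin (d + 1)))
    (t : ℝ) : ℝ :=
  ∫ y, ker s P (x - y) t * tauE E y


/-- The Laplacian `Δγ(0) = ∑ᵢ ∂²γ/∂yᵢ²(0)`. -/
def lap0 {d : ℕ} (γ : EuclideanSpace ℝ (Fin d) → ℝ) : ℝ :=
  ∑ i : Fin d,
    iteratedFDeriv ℝ 2 γ 0 ![EuclideanSpace.single i 1, EuclideanSpace.single i 1]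

/-! ### The splitting `ℝ^{d+1} = ℝ^d × ℝ` -/

lemma snocPt_castSucc {d : ℕ} (z : EuclideanSpace ℝ (Fin d)) (w : ℝ) (i : Fin d) :
    snocPt z w i.castSucc = z i := by
  simp [snocPt]

lemma snocPt_last {d : ℕ} (z : EuclideanSpace ℝ (Fin d)) (w : ℝ) :
    snocPt z w (Fin.last d) = w := by
  simp [snocPt]

lemma norm_sq_snocPt {d : ℕ} (z : EuclideanSpace ℝ (Fin d)) (w : ℝ) :
    ‖snocPt z w‖ ^ 2 = ‖z‖ ^ 2 + w ^ 2 := by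
  simp [EuclideanSpace.norm_sq_eq, Fin.sum_univ_castSucc, snocPt_castSucc, snocPt_last]

lemma norm_le_norm_snocPt {d : ℕ} (z : EuclideanSpace ℝ (Fin d)) (w : ℝ) :
    ‖z‖ ≤ ‖snocPt z w‖ := by
  refine abs_le_of_sq_le_sq' ?_ (norm_nonneg _) |>.2
  rw [norm_sq_snocPt]; nlinarith [sq_nonneg w]

lemma abs_le_norm_snocPt {d : ℕ} (z : EuclideanSpace ℝ (Fin d)) (w : ℝ) :
    |w| ≤ ‖snocPt z w‖ := by
  refine abs_le_of_sq_le_sq ?_ (norm_nonneg _)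
  rw [norm_sq_snocPt]; nlinarith [sq_nonneg ‖z‖]

lemma norm_snocPt_le {d : ℕ} (z : EuclideanSpace ℝ (Fin d)) (w : ℝ) :
    ‖snocPt z w‖ ≤ ‖z‖ + |w| := by
  refine abs_le_of_sq_le_sq' ?_ (by positivity) |>.2
  rw [norm_sq_snocPt]
  nlinarith [mul_nonneg (norm_nonneg z) (abs_nonneg w), sq_abs w]

lemma norm_snocPt_zero {d : ℕ} (z : EuclideanSpace ℝ (Fin d)) : ‖snocPt z 0‖ = ‖z‖ := by
  have h := norm_sq_snocPt z 0
  exact (pow_left_inj₀ (norm_nonneg _) (norm_nonneg _) two_ne_zero).1 (by simpa using h)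

lemma norm_snocPt_neg {d : ℕ} (z : EuclideanSpace ℝ (Fin d)) (w : ℝ) :
    ‖snocPt z (-w)‖ = ‖snocPt z w‖ :=
  (pow_left_inj₀ (norm_nonneg _) (norm_nonneg _) two_ne_zero).1 (by simp [norm_sq_snocPt])

lemma smul_eN_add_smul_snocPt {d : ℕ} (a ε : ℝ) (z : EuclideanSpace ℝ (Fin d)) (w : ℝ) :
    a • eN d + ε • snocPt z w = snocPt (ε • z) (a + ε * w) := by
  ext i
  refine Fin.lastCases ?_ (fun i => ?_) i
  · simp [snocPt_last, eN]
  · simp [snocPt_castSucc, eN, Fin.castSucc_ne_last]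

lemma snocPt_sub_snocPt {d : ℕ} (z z' : EuclideanSpace ℝ (Fin d)) (w w' : ℝ) :
    snocPt z w - snocPt z' w' = snocPt (z - z') (w - w') := by
  ext i
  refine Fin.lastCases ?_ (fun i => ?_) i <;> simp [snocPt_last, snocPt_castSucc]

lemma continuous_snocPt {d : ℕ} :
    Continuous fun q : EuclideanSpace ℝ (Fin d) × ℝ => snocPt q.1 q.2 := by
  refine (EuclideanSpace.equiv (Fin (d + 1)) ℝ).symm.continuous.comp ?_
  refine continuous_pi fun i => ?_
  refine Fin.lastCases ?_ (fun i => ?_) i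
  · simpa using continuous_snd
  · simpa using (by fun_prop : Continuous fun q : EuclideanSpace ℝ (Fin d) × ℝ => q.1 i)

/-- `(w, z) ↦ snocPt z w` as a measurable equivalence. -/
def snocEquiv (d : ℕ) : (ℝ × EuclideanSpace ℝ (Fin d)) ≃ᵐ EuclideanSpace ℝ (Fin (d + 1)) :=
  ((MeasurableEquiv.refl ℝ).prodCongr (MeasurableEquiv.toLp 2 (Fin d → ℝ)).symm).trans
    ((MeasurableEquiv.piFinSuccAbove (fun _ : Fin (d + 1) => ℝ) (Fin.last d)).symm.trans
      (MeasurableEquiv.toLp 2 (Fin (d + 1) → ℝ)))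

lemma snocEquiv_apply {d : ℕ} (q : ℝ × EuclideanSpace ℝ (Fin d)) :
    snocEquiv d q = snocPt q.2 q.1 := by
  simp [snocEquiv, snocPt, MeasurableEquiv.piFinSuccAbove, Fin.insertNthEquiv]
  exact ⟨rfl, rfl⟩

lemma measurePreserving_snocPt (d : ℕ) :
    MeasurePreserving (fun q : EuclideanSpace ℝ (Fin d) × ℝ => snocPt q.1 q.2)
      (volume.prod volume) volume := by
  have h : MeasurePreserving (snocEquiv d) (volume.prod volume) volume := by
    have h1 : MeasurePreserving
        ((MeasurableEquiv.refl ℝ).prodCongr (MeasurableEquiv.toLp 2 (Fin d → ℝ)).symm)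
        (volume.prod volume) (volume.prod volume) :=
      (MeasurePreserving.id _).prod (PiLp.volume_preserving_ofLp (Fin d))
    exact h1.trans
      ((volume_preserving_piFinSuccAbove (fun _ : Fin (d + 1) => ℝ) (Fin.last d)).symm.trans
        (EuclideanSpace.volume_preserving_symm_measurableEquiv_toLp _).symm)
  convert h.comp Measure.measurePreserving_swap using 1
  ext1 q
  exact (snocEquiv_apply q.swap).symm

lemma measurableEmbedding_snocPt (d : ℕ) :
    MeasurableEmbedding (fun q : EuclideanSpace ℝ (Fin d) × ℝ => snocPt q.1 q.2) := by
  convert (snocEquiv d).measurableEmbedding.comp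
    (MeasurableEquiv.prodComm (α := EuclideanSpace ℝ (Fin d)) (β := ℝ)).measurableEmbedding
    using 1
  ext1 q
  exact (snocEquiv_apply q.swap).symm

/-! ### Rescaling -/

lemma uF_eq_integral_rescaled {d : ℕ} {s : ℝ} (hs : 0 < s)
    {P : EuclideanSpace ℝ (Fin (d + 1)) → ℝ} (hPrad : ∀ x y, ‖x‖ = ‖y‖ → P x = P y)
    (E : Set (EuclideanSpace ℝ (Fin (d + 1)))) (x : EuclideanSpace ℝ (Fin (d + 1)))
    {ε : ℝ} (hε : 0 < ε) :
    uF s P E x ((ε ^ 2) ^ s) = ∫ z, P z * tauE E (x + ε • z) := by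
  have e1 : ((ε ^ 2) ^ s) ^ (-(((d : ℝ) + 1) / (2 * s))) = (ε ^ (d + 1))⁻¹ := by
    rw [← rpow_natCast ε 2, ← rpow_mul hε.le, ← rpow_mul hε.le, ← rpow_natCast ε (d + 1),
      ← rpow_neg hε.le]
    congr 1
    push_cast
    field_simp
  have e2 : ((ε ^ 2) ^ s) ^ (-(1 : ℝ) / (2 * s)) = ε⁻¹ := by
    rw [← rpow_natCast ε 2, ← rpow_mul hε.le, ← rpow_mul hε.le, ← rpow_neg_one]
    congr 1
    push_cast
    field_simp
  have h2 : ∀ y, ker s P (x - y) ((ε ^ 2) ^ s) * tauE E y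
      = (fun q => (ε ^ (d + 1))⁻¹ * (P (ε⁻¹ • q) * tauE E (x + q))) (y - x) := by
    intro y
    simp only [ker, e1, e2, add_sub_cancel]
    rw [hPrad (ε⁻¹ • (x - y)) (ε⁻¹ • (y - x)) (by rw [norm_smul, norm_smul, norm_sub_rev])]
    ring
  rw [uF, integral_congr_ae (Filter.Eventually.of_forall h2),
    integral_sub_right_eq_self (fun q => (ε ^ (d + 1))⁻¹ * (P (ε⁻¹ • q) * tauE E (x + q)))]
  rw [integral_const_mul]
  have h3 := Measure.integral_comp_smul volume
    (fun q => P (ε⁻¹ • q) * tauE E (x + q)) ε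
  simp only [smul_smul, inv_mul_cancel₀ hε.ne', one_smul, finrank_euclideanSpace,
    Fintype.card_fin, smul_eq_mul] at h3
  rw [h3, abs_of_pos (by positivity)]

/-! ### Weights -/

lemma integrable_one_div_one_add_norm_rpow {n : ℕ} {p : ℝ} (hp : (n : ℝ) < p) :
    Integrable fun z : EuclideanSpace ℝ (Fin n) => 1 / (1 + ‖z‖ ^ p) := by
  have hp0 : 0 < p := lt_of_le_of_lt (Nat.cast_nonneg n) hp
  have h := (integrable_one_add_norm (E := EuclideanSpace ℝ (Fin n)) (μ := volume) (r := p)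
    (by simpa using hp)).const_mul (2 ^ p)
  refine h.mono' ?_ (Filter.Eventually.of_forall fun z => ?_)
  · refine Continuous.aestronglyMeasurable ?_
    refine continuous_const.div (continuous_const.add
      (continuous_norm.rpow_const fun _ => Or.inr hp0.le)) fun z => ?_
    positivity
  · rw [norm_of_nonneg (by positivity), rpow_neg (by positivity), ← div_eq_mul_inv,
      div_le_div_iff₀ (by positivity) (by positivity)]
    have hz := norm_nonneg z
    rcases le_total ‖z‖ 1 with h1 | h1
    · have : (1 + ‖z‖) ^ p ≤ 2 ^ p := rpow_le_rpow (by positivity) (by linarith) hp0.le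
      have h3 : 0 ≤ ‖z‖ ^ p := by positivity
      have h4 : (0:ℝ) ≤ 2 ^ p := by positivity
      nlinarith
    · have : (1 + ‖z‖) ^ p ≤ (2 * ‖z‖) ^ p := rpow_le_rpow (by positivity) (by linarith) hp0.le
      rw [mul_rpow (by norm_num) hz] at this
      have h4 : (0:ℝ) ≤ 2 ^ p := by positivity
      nlinarith

lemma integrable_norm_sq_div_one_add_norm_rpow {n : ℕ} {p : ℝ} (hp : (n : ℝ) + 2 < p) :
    Integrable fun z : EuclideanSpace ℝ (Fin n) => ‖z‖ ^ 2 * (1 / (1 + ‖z‖ ^ p)) := by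
  have hn : (0:ℝ) ≤ n := Nat.cast_nonneg n
  have hp0 : 0 < p := by linarith
  have h := (integrable_one_div_one_add_norm_rpow (n := n) (p := p - 2)
    (by linarith)).const_mul 2
  refine h.mono' ?_ (Filter.Eventually.of_forall fun z => ?_)
  · refine Continuous.aestronglyMeasurable ?_
    refine (continuous_norm.pow 2).mul (continuous_const.div (continuous_const.add
      (continuous_norm.rpow_const fun _ => Or.inr hp0.le)) fun z => ?_)
    positivity
  · rw [norm_of_nonneg (by positivity), mul_one_div, mul_one_div,
      div_le_div_iff₀ (by positivity) (by positivity)]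
    have hz := norm_nonneg z
    have e : ‖z‖ ^ 2 * ‖z‖ ^ (p - 2) = ‖z‖ ^ p := by
      rw [← rpow_natCast, ← rpow_add_of_nonneg hz (by simp) (by linarith)]
      congr 1; push_cast; ring
    have h5 : ‖z‖ ^ 2 ≤ 1 + ‖z‖ ^ p := by
      rcases le_total ‖z‖ 1 with h1 | h1
      · have : 0 ≤ ‖z‖ ^ p := by positivity
        nlinarith
      · have := rpow_le_rpow_of_exponent_le h1 (by linarith : (2:ℝ) ≤ p)
        rw [rpow_two] at this
        linarith
    have h6 : 0 ≤ ‖z‖ ^ p := by positivity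
    nlinarith

/-- Scaling of the tail of `‖z‖ ^ (-q)` outside a ball. -/
lemma exists_integral_tail_eq {n : ℕ} [NeZero n] {q κ : ℝ} (hκ : 0 < κ) (hq : (n : ℝ) < q) :
    ∃ J : ℝ, ∀ ε : ℝ, 0 < ε →
      Integrable ({z : EuclideanSpace ℝ (Fin n) | κ ≤ ε * ‖z‖}.indicator
        fun z => ‖z‖ ^ (-q)) ∧
      ∫ z : EuclideanSpace ℝ (Fin n), {z | κ ≤ ε * ‖z‖}.indicator (fun z => ‖z‖ ^ (-q)) z
        = J * ε ^ (q - n) := by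
  set f : EuclideanSpace ℝ (Fin n) → ℝ := fun z => {z | κ ≤ ‖z‖}.indicator
    (fun z => ‖z‖ ^ (-q)) z with hf
  have hfi : Integrable f := by
    have hn : 1 ≤ n := NeZero.one_le
    have hq0 : 0 < q := lt_of_le_of_lt (Nat.cast_nonneg n) hq
    refine ((integrable_one_div_one_add_norm_rpow hq).const_mul (κ ^ (-q) + 1)).mono' ?_
      (Filter.Eventually.of_forall fun z => ?_)
    · refine (Measurable.indicator ?_ ?_).aestronglyMeasurable
      · fun_prop
      · exact measurableSet_le measurable_const measurable_norm
    · simp only [hf, indicator, mem_ofPred_eq]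
      split_ifs with h
      · have hz : 0 < ‖z‖ := hκ.trans_le h
        have h1 : 0 < ‖z‖ ^ q := by positivity
        rw [norm_of_nonneg (by positivity), rpow_neg hz.le, rpow_neg hκ.le, mul_one_div,
          le_div_iff₀ (by positivity), mul_add, inv_mul_cancel₀ h1.ne', mul_one]
        gcongr
      · rw [norm_zero]; positivity
  refine ⟨∫ z, f z, fun ε hε => ?_⟩
  have h1 : ({z : EuclideanSpace ℝ (Fin n) | κ ≤ ε * ‖z‖}.indicator
      fun z => ‖z‖ ^ (-q)) = fun z => ε ^ q * f (ε • z) := by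
    ext z
    simp only [hf, indicator, mem_ofPred_eq, norm_smul, norm_of_nonneg hε.le]
    split_ifs with h
    · rw [mul_rpow hε.le (norm_nonneg _), ← mul_assoc, ← rpow_add hε]; simp
    · simp
  rw [h1]
  refine ⟨((integrable_comp_smul_iff volume f hε.ne').2 hfi).const_mul _, ?_⟩
  rw [integral_const_mul, Measure.integral_comp_smul]
  simp only [finrank_euclideanSpace, Fintype.card_fin, smul_eq_mul]
  rw [abs_of_pos (by positivity), rpow_sub hε, rpow_natCast]
  field_simp

/-- Scaling of the integral of `min 1 (ε ‖z‖) ‖z‖ ^ (-q)`. -/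
lemma exists_integral_min_eq {n : ℕ} [NeZero n] {q : ℝ} (hq : (n : ℝ) < q)
    (hq' : q < n + 1) :
    ∃ J : ℝ, ∀ ε : ℝ, 0 < ε →
      Integrable (fun z : EuclideanSpace ℝ (Fin n) => min 1 (ε * ‖z‖) * ‖z‖ ^ (-q)) ∧
      ∫ z : EuclideanSpace ℝ (Fin n), min 1 (ε * ‖z‖) * ‖z‖ ^ (-q) = J * ε ^ (q - n) := by
  set f : EuclideanSpace ℝ (Fin n) → ℝ := fun z => min 1 ‖z‖ * ‖z‖ ^ (-q) with hf
  have hn : 1 ≤ n := NeZero.one_le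
  have hfi : Integrable f := by
    have : Nontrivial (EuclideanSpace ℝ (Fin n)) := by
      refine Module.nontrivial_of_finrank_pos (R := ℝ) ?_
      simp; omega
    refine (integrable_fun_norm_addHaar volume (f := fun y : ℝ => min 1 y * y ^ (-q))).2 ?_
    simp only [finrank_euclideanSpace, Fintype.card_fin, smul_eq_mul]
    rw [← Ioc_union_Ioi_eq_Ioi zero_le_one]
    refine IntegrableOn.union ?_ ?_
    · have h : IntegrableOn (fun y : ℝ => y ^ ((n:ℝ) - q)) (Ioc 0 1) :=
        (intervalIntegral.intervalIntegrable_rpow' (by linarith : -1 < (n:ℝ) - q)).1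
      refine h.congr_fun (fun y hy => ?_) measurableSet_Ioc
      have : (n:ℝ) - q = ((n - 1 : ℕ) : ℝ) + (1 + (-q)) := by push_cast [hn]; ring
      simp only
      rw [min_eq_right hy.2, this, rpow_add hy.1, rpow_natCast, rpow_add hy.1, rpow_one]
    · have h : IntegrableOn (fun y : ℝ => y ^ ((n:ℝ) - 1 - q)) (Ioi 1) :=
        integrableOn_Ioi_rpow_of_lt (by linarith) one_pos
      refine h.congr_fun (fun y hy => ?_) measurableSet_Ioi
      have hy0 : 0 < y := one_pos.trans hy
      have : (n:ℝ) - 1 - q = ((n - 1 : ℕ) : ℝ) + (-q) := by push_cast [hn]; ring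
      simp only
      rw [min_eq_left (le_of_lt hy), this, rpow_add hy0, rpow_natCast, one_mul]
  refine ⟨∫ z, f z, fun ε hε => ?_⟩
  have h1 : (fun z : EuclideanSpace ℝ (Fin n) => min 1 (ε * ‖z‖) * ‖z‖ ^ (-q))
      = fun z => ε ^ q * f (ε • z) := by
    ext z
    simp only [hf, norm_smul, norm_of_nonneg hε.le]
    rw [mul_rpow hε.le (norm_nonneg _), rpow_neg hε.le]
    have : ε ^ q ≠ 0 := by positivity
    field_simp
  rw [h1]
  refine ⟨((integrable_comp_smul_iff volume f hε.ne').2 hfi).const_mul _, ?_⟩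
  rw [integral_const_mul, Measure.integral_comp_smul]
  simp only [finrank_euclideanSpace, Fintype.card_fin, smul_eq_mul]
  rw [abs_of_pos (by positivity), rpow_sub hε, rpow_natCast]
  field_simp

lemma exists_eq_snocPt {d : ℕ} (y : EuclideanSpace ℝ (Fin (d + 1))) :
    ∃ z w, y = snocPt z w := by
  obtain ⟨q, rfl⟩ := (snocEquiv d).surjective y
  exact ⟨q.2, q.1, snocEquiv_apply q⟩

/-! ### The graph -/

lemma exists_taylor_bound {V : Type*} [NormedAddCommGroup V] [NormedSpace ℝ V]
    {γ : V → ℝ} {r : ℝ} (hr : 0 < r)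
    (hγ3 : ContDiffOn ℝ 3 γ (ball 0 r)) (hγ0 : γ 0 = 0)
    (hdγ0 : fderivWithin ℝ γ (ball 0 r) 0 = 0) :
    ∃ ρ > 0, ρ < r ∧ ∃ K : ℝ, 0 ≤ K ∧ ∀ y : V, ‖y‖ < ρ →
      |γ y - 1 / 2 * fderiv ℝ (fderiv ℝ γ) 0 y y| ≤ K * ‖y‖ ^ 3 := by
  have hat : ∀ y ∈ ball (0 : V) r, ContDiffAt ℝ 3 γ y := fun y hy =>
    hγ3.contDiffAt (isOpen_ball.mem_nhds hy)
  have hat0 := hat 0 (mem_ball_self hr)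
  have hd1 : ∀ y ∈ ball (0 : V) r, ContDiffAt ℝ 2 (fderiv ℝ γ) y := fun y hy =>
    (hat y hy).fderiv_right (by norm_num)
  have hd2 : ∀ y ∈ ball (0 : V) r, ContDiffAt ℝ 1 (fderiv ℝ (fderiv ℝ γ)) y := fun y hy =>
    (hd1 y hy).fderiv_right (by norm_num)
  rw [fderivWithin_of_isOpen isOpen_ball (mem_ball_self hr)] at hdγ0
  obtain ⟨K, t, ht, hK⟩ := (hd2 0 (mem_ball_self hr)).exists_lipschitzOnWith
  obtain ⟨δ, hδ, hδt⟩ := Metric.mem_nhds_iff.1 ht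
  set B := fderiv ℝ (fderiv ℝ γ) 0 with hB
  have hsymm : ∀ x y, B x y = B y x := fun x y =>
    (hat0.isSymmSndFDerivAt (by
      rw [minSmoothness_of_isRCLikeNormedField]; norm_num)).eq x y
  refine ⟨min δ (r / 2), by positivity, (min_le_right _ _).trans_lt (by linarith), K, K.2,
    fun y hy => ?_⟩
  have hyr : ‖y‖ < r := hy.trans ((min_le_right _ _).trans_lt (by linarith))
  have hyδ : ‖y‖ < δ := hy.trans_le (min_le_left _ _)
  have hmem : ∀ x ∈ closedBall (0 : V) ‖y‖, x ∈ ball (0 : V) r := fun x hx => by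
    simp only [mem_closedBall, dist_zero_right, mem_ball] at hx ⊢; linarith
  have h0 : (0 : V) ∈ closedBall (0 : V) ‖y‖ := mem_closedBall_self (norm_nonneg _)
  have b2 : ∀ x ∈ closedBall (0 : V) ‖y‖, ‖fderiv ℝ (fderiv ℝ γ) x - B‖ ≤ K * ‖y‖ := by
    intro x hx
    simp only [mem_closedBall, dist_zero_right] at hx
    have := hK.dist_le_mul x (hδt (by simp; linarith)) 0 (hδt (by simp; linarith))
    rw [dist_eq_norm, dist_zero_right] at this
    exact this.trans (by gcongr)
  have b1 : ∀ x ∈ closedBall (0 : V) ‖y‖, ‖fderiv ℝ γ x - B x‖ ≤ K * ‖y‖ ^ 2 := by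
    intro x hx
    have := Convex.norm_image_sub_le_of_norm_hasFDerivWithin_le (𝕜 := ℝ)
      (f := fun x => fderiv ℝ γ x - B x) (f' := fun x => fderiv ℝ (fderiv ℝ γ) x - B)
      (fun x hx => ((((hd1 x (hmem x hx)).differentiableAt (by norm_num)).hasFDerivAt).sub
        B.hasFDerivAt).hasFDerivWithinAt) b2 (convex_closedBall 0 ‖y‖) h0 hx
    simp only [hdγ0, map_zero, sub_zero] at this
    refine this.trans ?_
    rw [pow_two, ← mul_assoc]
    have hx' : ‖x‖ ≤ ‖y‖ := by simpa using hx
    gcongr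
  have hyy : y ∈ closedBall (0 : V) ‖y‖ := by simp
  have := Convex.norm_image_sub_le_of_norm_hasFDerivWithin_le (𝕜 := ℝ)
      (f := fun x => γ x - 1 / 2 * B x x) (f' := fun x => fderiv ℝ γ x - B x)
      (fun x hx => by
        have h1 := ((hat x (hmem x hx)).differentiableAt (by norm_num)).hasFDerivAt
        have h2 := (B.hasFDerivAt (x := x)).clm_apply (hasFDerivAt_id x)
        have h3 := (h1.sub (h2.const_mul (1 / 2))).hasFDerivWithinAt
          (s := closedBall (0 : V) ‖y‖)
        refine h3.congr_fderiv ?_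
        ext w
        simp [hsymm w x]
        ring) b1 (convex_closedBall 0 ‖y‖) h0 hyy
  simp only [hγ0, map_zero, sub_zero, mul_zero, norm_eq_abs] at this
  refine this.trans (le_of_eq ?_)
  ring

lemma tauE_of_lt {d : ℕ} {E : Set (EuclideanSpace ℝ (Fin (d + 1)))} {r : ℝ}
    {γ : EuclideanSpace ℝ (Fin d) → ℝ}
    (hEQ : ∀ (y' : EuclideanSpace ℝ (Fin d)) (a : ℝ), ‖y'‖ < r → |a| < r →
      (snocPt y' a ∈ E ↔ γ y' < a))
    {y : EuclideanSpace ℝ (Fin d)} {a : ℝ} (hy : ‖y‖ < r) (ha : |a| < r) (h : γ y < a) :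
    tauE E (snocPt y a) = 1 := by
  have hE := (hEQ y a hy ha).2 h
  simp [tauE, hE, subset_closure hE]

lemma tauE_of_gt {d : ℕ} {E : Set (EuclideanSpace ℝ (Fin (d + 1)))} {r : ℝ}
    {γ : EuclideanSpace ℝ (Fin d) → ℝ} (hγ : ContinuousOn γ (ball 0 r))
    (hEQ : ∀ (y' : EuclideanSpace ℝ (Fin d)) (a : ℝ), ‖y'‖ < r → |a| < r →
      (snocPt y' a ∈ E ↔ γ y' < a))
    {y : EuclideanSpace ℝ (Fin d)} {a : ℝ} (hy : ‖y‖ < r) (ha : |a| < r) (h : a < γ y) :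
    tauE E (snocPt y a) = -1 := by
  have hE : snocPt y a ∉ closure E := by
    intro hcl
    have hc : ContinuousAt γ y := hγ.continuousAt (isOpen_ball.mem_nhds (by simpa using hy))
    have h1 : ∀ᶠ q : EuclideanSpace ℝ (Fin d) × ℝ in nhds (y, a), q.2 < γ q.1 :=
      continuousAt_snd.eventually_lt (ContinuousAt.comp (f := Prod.fst) hc continuousAt_fst) h
    have h2 : ∀ᶠ q : EuclideanSpace ℝ (Fin d) × ℝ in nhds (y, a), ‖q.1‖ < r :=
      (continuous_fst.norm.continuousAt).eventually_lt continuousAt_const hy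
    have h3 : ∀ᶠ q : EuclideanSpace ℝ (Fin d) × ℝ in nhds (y, a), |q.2| < r :=
      (continuous_snd.abs.continuousAt).eventually_lt continuousAt_const ha
    obtain ⟨δ, hδ, H⟩ := Metric.eventually_nhds_iff.1 (h1.and (h2.and h3))
    obtain ⟨x, hxE, hx⟩ := Metric.mem_closure_iff.1 hcl δ hδ
    obtain ⟨z, w, rfl⟩ := exists_eq_snocPt x
    rw [dist_comm, dist_eq_norm, snocPt_sub_snocPt] at hx
    have := @H (z, w) (by
      rw [Prod.dist_eq, dist_eq_norm, dist_eq_norm, max_lt_iff]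
      exact ⟨(norm_le_norm_snocPt _ _).trans_lt hx, (abs_le_norm_snocPt _ _).trans_lt hx⟩)
    exact lt_asymm ((hEQ z w this.2.1 this.2.2).1 hxE) this.1
  have hE' : snocPt y a ∉ E := fun h => hE (subset_closure h)
  simp [tauE, hE, hE']

lemma abs_tauE_le {d : ℕ} (E : Set (EuclideanSpace ℝ (Fin (d + 1)))) (y) :
    |tauE E y| ≤ 1 := by
  by_cases h1 : y ∈ E
  · simp [tauE, h1, subset_closure h1]
  · by_cases h2 : y ∈ closure E <;> simp [tauE, h1, h2]

lemma measurable_tauE {d : ℕ} {E : Set (EuclideanSpace ℝ (Fin (d + 1)))} (hE : IsOpen E) :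
    Measurable (tauE E) :=
  (measurable_const.indicator hE.measurableSet).sub
    (measurable_const.indicator isClosed_closure.measurableSet.compl)

/-! ### Integration of an even function against a sign -/

lemma setIntegral_even_mul_sign {p σ : ℝ → ℝ} (hp : Continuous p) (heven : ∀ w, p (-w) = p w)
    {L b : ℝ} (hb : |b| ≤ L) (h1 : ∀ w, |w| < L → b < w → σ w = 1)
    (h2 : ∀ w, |w| < L → w < b → σ w = -1) :
    ∫ w in Ioo (-L) L, p w * σ w = -2 * ∫ w in 0..b, p w := by
  obtain ⟨hb1, hb2⟩ := abs_le.1 hb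
  have hI : ∀ u v, IntervalIntegrable p volume u v := fun u v => hp.intervalIntegrable u v
  have c1 : ∀ᵐ w, w ∈ uIoc (-L) b → -p w = p w * σ w := by
    filter_upwards [Measure.ae_ne volume b] with w hw hwI
    rw [uIoc_of_le hb1] at hwI
    have hlt := lt_of_le_of_ne hwI.2 hw
    rw [h2 w (abs_lt.2 ⟨hwI.1, by linarith⟩) hlt]; ring
  have c2 : ∀ᵐ w, w ∈ uIoc b L → p w = p w * σ w := by
    filter_upwards [Measure.ae_ne volume L] with w hw hwI
    rw [uIoc_of_le hb2] at hwI
    have hlt := lt_of_le_of_ne hwI.2 hw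
    rw [h1 w (abs_lt.2 ⟨by linarith [hwI.1], hlt⟩) hwI.1]; ring
  rw [← integral_Ioc_eq_integral_Ioo, ← intervalIntegral.integral_of_le (by linarith),
    ← intervalIntegral.integral_add_adjacent_intervals (b := b)
      (((hI _ _).neg).congr_ae ((ae_restrict_iff' measurableSet_uIoc).2 c1))
      ((hI _ _).congr_ae ((ae_restrict_iff' measurableSet_uIoc).2 c2)),
    ← intervalIntegral.integral_congr_ae c1, ← intervalIntegral.integral_congr_ae c2,
    intervalIntegral.integral_neg]
  have e1 := intervalIntegral.integral_comp_neg (a := 0) (b := L) p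
  simp only [heven, neg_zero] at e1
  have e2 := intervalIntegral.integral_add_adjacent_intervals (hI (-L) 0) (hI 0 b)
  have e3 := intervalIntegral.integral_add_adjacent_intervals (hI 0 b) (hI b L)
  linarith

/-! ### Quadratic forms against radial functions -/

lemma integral_apply_mul_apply_mul_radial_eq_zero {n : ℕ} {φ : EuclideanSpace ℝ (Fin n) → ℝ}
    (hφ : ∀ x y, ‖x‖ = ‖y‖ → φ x = φ y) {i j : Fin n} (hij : i ≠ j) :
    ∫ z, z i * z j * φ z = 0 := by
  let U : EuclideanSpace ℝ (Fin n) ≃ₗᵢ[ℝ] EuclideanSpace ℝ (Fin n) :=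
    LinearIsometryEquiv.piLpCongrRight 2
      (fun k => if k = i then LinearIsometryEquiv.neg ℝ else LinearIsometryEquiv.refl ℝ ℝ)
  have hU := U.measurePreserving.integral_comp U.toHomeomorph.measurableEmbedding
    (fun z => z i * z j * φ z)
  have e : ∀ z, (U z) i * (U z) j * φ (U z) = -(z i * z j * φ z) := by
    intro z
    rw [hφ (U z) z (U.norm_map z)]
    simp [U, hij.symm]
  simp only [e, integral_neg] at hU
  linarith

lemma integral_apply_sq_mul_radial_eq {n : ℕ} {φ : EuclideanSpace ℝ (Fin n) → ℝ}
    (hφ : ∀ x y, ‖x‖ = ‖y‖ → φ x = φ y) (i j : Fin n) :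
    ∫ z, z i * z i * φ z = ∫ z, z j * z j * φ z := by
  let U : EuclideanSpace ℝ (Fin n) ≃ₗᵢ[ℝ] EuclideanSpace ℝ (Fin n) :=
    LinearIsometryEquiv.piLpCongrLeft 2 ℝ ℝ (Equiv.swap i j)
  have hU := U.measurePreserving.integral_comp U.toHomeomorph.measurableEmbedding
    (fun z => z i * z i * φ z)
  rw [← hU]
  refine integral_congr_ae (Filter.Eventually.of_forall fun z => ?_)
  simp only
  rw [hφ (U z) z (U.norm_map z)]
  simp [U, LinearIsometryEquiv.piLpCongrLeft_apply]

lemma integral_quadratic_mul_radial {n : ℕ} (hn : 1 ≤ n) {φ : EuclideanSpace ℝ (Fin n) → ℝ}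
    (hφ : ∀ x y, ‖x‖ = ‖y‖ → φ x = φ y) (hm : AEStronglyMeasurable φ)
    (hInt : Integrable fun z => ‖z‖ ^ 2 * φ z)
    (B : EuclideanSpace ℝ (Fin n) →L[ℝ] EuclideanSpace ℝ (Fin n) →L[ℝ] ℝ) :
    ∫ z, B z z * φ z = (∑ i, B (EuclideanSpace.single i 1) (EuclideanSpace.single i 1)) / n *
      ∫ z, ‖z‖ ^ 2 * φ z := by
  have hij : ∀ i j : Fin n, Integrable fun z : EuclideanSpace ℝ (Fin n) => z i * z j * φ z := by
    intro i j
    refine hInt.mono ?_ (Filter.Eventually.of_forall fun z => ?_)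
    · exact (Continuous.aestronglyMeasurable (by fun_prop)).mul hm
    · rw [norm_mul, norm_mul, norm_mul, norm_pow, norm_norm, pow_two]
      gcongr <;> exact PiLp.norm_apply_le z _
  have hexp : ∀ z, B z z * φ z = ∑ i, ∑ j, B (EuclideanSpace.single i 1)
      (EuclideanSpace.single j 1) * (z i * z j * φ z) := by
    intro z
    have hz : z = ∑ i, z i • EuclideanSpace.single i (1:ℝ) := by
      have := (EuclideanSpace.basisFun (Fin n) ℝ).sum_repr z
      simpa using this.symm
    conv_lhs => rw [hz]
    simp only [map_sum, map_smul, _root_.sum_apply, _root_.smul_apply,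
      smul_eq_mul, Finset.sum_mul, Finset.mul_sum]
    rw [Finset.sum_comm]
    refine Finset.sum_congr rfl fun i _ => Finset.sum_congr rfl fun j _ => ?_
    rw [← hz]
    ring
  have hsq : ∀ i : Fin n, ∫ z, z i * z i * φ z = (∫ z, ‖z‖ ^ 2 * φ z) / n := by
    intro i
    have : ∫ z : EuclideanSpace ℝ (Fin n), ‖z‖ ^ 2 * φ z = ∑ j, ∫ z, z j * z j * φ z := by
      rw [← integral_finsetSum _ fun j _ => hij j j]
      refine integral_congr_ae (Filter.Eventually.of_forall fun z => ?_)
      simp only [EuclideanSpace.norm_sq_eq, Finset.sum_mul, norm_eq_abs, sq_abs]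
      simp only [pow_two]
    rw [this, Finset.sum_congr rfl fun j _ => integral_apply_sq_mul_radial_eq hφ j i]
    have : (n:ℝ) ≠ 0 := by positivity
    simp only [Finset.sum_const, Finset.card_univ, Fintype.card_fin, nsmul_eq_mul]
    field_simp
  simp only [hexp]
  rw [integral_finsetSum _ fun i _ => integrable_finsetSum _ fun j _ => (hij i j).const_mul _]
  rw [Finset.sum_div, Finset.sum_mul]
  refine Finset.sum_congr rfl fun i _ => ?_
  rw [integral_finsetSum _ fun j _ => (hij i j).const_mul _, Finset.sum_eq_single i]
  · rw [integral_const_mul, hsq]; ring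
  · intro j _ hji
    rw [integral_const_mul, integral_apply_mul_apply_mul_radial_eq_zero hφ hji.symm, mul_zero]
  · simp

/-! ### Kernels with algebraic decay -/

/-- A radial continuous kernel on `ℝ^d × ℝ` comparable to `(1 + ‖y‖ ^ p)⁻¹`, with
slice-wise Lipschitz bound of order `(1 + ‖z‖ ^ (p + 1))⁻¹`. -/
structure KernelBounds (d : ℕ) (p C : ℝ) (P : EuclideanSpace ℝ (Fin (d + 1)) → ℝ) : Prop where
  radial : ∀ x y, ‖x‖ = ‖y‖ → P x = P y
  continuous : Continuous P
  one_le : 1 ≤ C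
  lower : ∀ y, C⁻¹ / (1 + ‖y‖ ^ p) ≤ P y
  upper : ∀ y, P y ≤ C * (1 / (1 + ‖y‖ ^ p))
  lipschitz : ∀ z w, |P (snocPt z w) - P (snocPt z 0)| ≤ C / (1 + ‖z‖ ^ (p + 1)) * |w|

lemma KernelBounds.of_fderiv_le {d : ℕ} {p C : ℝ} {P : EuclideanSpace ℝ (Fin (d + 1)) → ℝ}
    (hp : 0 ≤ p) (hPrad : ∀ x y, ‖x‖ = ‖y‖ → P x = P y) (hP1 : ContDiff ℝ 1 P) (hC : 1 ≤ C)
    (hPlow : ∀ y, C⁻¹ / (1 + ‖y‖ ^ p) ≤ P y) (hPup : ∀ y, P y ≤ C / (1 + ‖y‖ ^ p))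
    (hPgrad : ∀ y, ‖fderiv ℝ P y‖ ≤ C / (1 + ‖y‖ ^ (p + 1))) : KernelBounds d p C P where
  radial := hPrad
  continuous := hP1.continuous
  one_le := hC
  lower := hPlow
  upper y := by rw [mul_one_div]; exact hPup y
  lipschitz z w := by
    have hseg : ∀ x ∈ segment ℝ (snocPt z 0) (snocPt z w), ‖z‖ ≤ ‖x‖ := by
      rintro x ⟨a, b, -, -, hab, rfl⟩
      have : a • snocPt z 0 + b • snocPt z w = snocPt z (b * w) := by
        ext i
        refine Fin.lastCases ?_ (fun i => ?_) i
        · simp [snocPt_last]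
        · simp [snocPt_castSucc, ← add_mul, hab]
      rw [this]
      exact norm_le_norm_snocPt _ _
    have h := Convex.norm_image_sub_le_of_norm_fderiv_le (𝕜 := ℝ) (f := P)
      (C := C / (1 + ‖z‖ ^ (p + 1))) (fun x _ => (hP1.differentiable (by norm_num)) x)
      (fun x hx => (hPgrad x).trans (by
        have := hseg x hx
        gcongr))
      (convex_segment _ _) (left_mem_segment ℝ (snocPt z 0) (snocPt z w))
      (right_mem_segment ℝ _ _)
    rwa [snocPt_sub_snocPt, sub_self, sub_zero, norm_eq_abs, (by
      have := norm_sq_snocPt (0 : EuclideanSpace ℝ (Fin d)) w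
      rw [norm_zero, zero_pow two_ne_zero, zero_add, ← sq_abs w] at this
      exact (pow_left_inj₀ (norm_nonneg _) (abs_nonneg _) two_ne_zero).1 this :
        ‖snocPt (0 : EuclideanSpace ℝ (Fin d)) w‖ = |w|)] at h

namespace KernelBounds

variable {d : ℕ} {p C : ℝ} {P : EuclideanSpace ℝ (Fin (d + 1)) → ℝ}

lemma const_pos (h : KernelBounds d p C P) : 0 < C := one_pos.trans_le h.one_le

lemma pos (h : KernelBounds d p C P) (y) : 0 < P y := by
  have := h.const_pos
  exact lt_of_lt_of_le (by positivity) (h.lower y)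

lemma upper_slice (h : KernelBounds d p C P) (hp : 0 ≤ p) (z w) :
    P (snocPt z w) ≤ C * (1 / (1 + ‖z‖ ^ p)) := by
  have := h.const_pos
  refine (h.upper _).trans ?_
  have := norm_le_norm_snocPt z w
  gcongr

lemma integrable (h : KernelBounds d p C P) (hp : (d : ℝ) + 1 < p) : Integrable P := by
  refine ((integrable_one_div_one_add_norm_rpow (n := d + 1) (by push_cast; exact hp)).const_mul
    C).mono' h.continuous.aestronglyMeasurable (Filter.Eventually.of_forall fun y => ?_)
  rw [norm_of_nonneg (h.pos y).le]
  exact h.upper y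

lemma continuous_slice (h : KernelBounds d p C P) (z) : Continuous fun w => P (snocPt z w) :=
  h.continuous.comp (continuous_snocPt.comp (by fun_prop : Continuous fun w : ℝ => (z, w)))

lemma continuous_slice_zero (h : KernelBounds d p C P) : Continuous fun z => P (snocPt z 0) :=
  h.continuous.comp (continuous_snocPt.comp
    (by fun_prop : Continuous fun z : EuclideanSpace ℝ (Fin d) => (z, (0:ℝ))))

lemma integrable_slice_zero (h : KernelBounds d p C P) (hp : (d : ℝ) < p) :
    Integrable fun z => P (snocPt z 0) := by
  have hp0 : 0 ≤ p := (Nat.cast_nonneg d).trans hp.le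
  refine ((integrable_one_div_one_add_norm_rpow hp).const_mul C).mono'
    h.continuous_slice_zero.aestronglyMeasurable (Filter.Eventually.of_forall fun z => ?_)
  rw [norm_of_nonneg (h.pos _).le]
  exact h.upper_slice hp0 z 0

lemma integrable_norm_sq_mul_slice_zero (h : KernelBounds d p C P) (hp : (d : ℝ) + 2 < p) :
    Integrable fun z => ‖z‖ ^ 2 * P (snocPt z 0) := by
  have hd : (0:ℝ) ≤ d := Nat.cast_nonneg d
  refine ((integrable_norm_sq_div_one_add_norm_rpow hp).const_mul C).mono'
    ((continuous_norm.pow 2).mul h.continuous_slice_zero).aestronglyMeasurable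
    (Filter.Eventually.of_forall fun z => ?_)
  rw [norm_of_nonneg (mul_nonneg (by positivity) (h.pos _).le)]
  have := h.upper_slice (by linarith) z 0
  have hz : 0 ≤ ‖z‖ ^ 2 := by positivity
  nlinarith

lemma integral_slice_zero_pos (h : KernelBounds d p C P) (hp : (d : ℝ) < p) :
    0 < ∫ z, P (snocPt z 0) := by
  refine (integral_pos_iff_support_of_nonneg (fun z => (h.pos _).le)
    (h.integrable_slice_zero hp)).2 ?_
  have : Function.support (fun z => P (snocPt z 0)) = univ := by
    ext z; simp [(h.pos _).ne']
  rw [this]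
  exact Measure.measure_univ_pos.2 (NeZero.ne _)

end KernelBounds

/-- If the rescaled solution vanishes, the mass between the rescaled graph and the hyperplane
through the base point is of the order of the tail of the kernel. -/
lemma exists_abs_integral_slab_le {d : ℕ} {s C : ℝ} (hs : 0 < s)
    {P : EuclideanSpace ℝ (Fin (d + 1)) → ℝ} (hP : KernelBounds d (d + 1 + 2 * s) C P)
    {E : Set (EuclideanSpace ℝ (Fin (d + 1)))} (hE : IsOpen E) {r ρ : ℝ} (hr : 0 < r)
    (hρ : 0 < ρ) (hρr : ρ ≤ r) {γ : EuclideanSpace ℝ (Fin d) → ℝ}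
    (hγ : ContinuousOn γ (ball 0 r)) (hγρ : ∀ y, ‖y‖ < ρ → |γ y| ≤ r / 4)
    (hEQ : ∀ (y' : EuclideanSpace ℝ (Fin d)) (a : ℝ), ‖y'‖ < r → |a| < r →
      (snocPt y' a ∈ E ↔ γ y' < a)) :
    ∃ C₀ : ℝ, 0 ≤ C₀ ∧ ∀ ε : ℝ, 0 < ε → ε ≤ r / 4 → ∀ a : ℝ, |a| ≤ ε →
      ∫ z, P z * tauE E (a • eN d + ε • z) = 0 →
      IntegrableOn (fun z => ∫ w in 0..(γ (ε • z) - a) / ε, P (snocPt z w))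
        (ball 0 (ρ / ε)) ∧
      |∫ z in ball 0 (ρ / ε), ∫ w in 0..(γ (ε • z) - a) / ε, P (snocPt z w)|
        ≤ C₀ * ε ^ (2 * s) := by
  have hC := hP.const_pos
  set p : ℝ := d + 1 + 2 * s with hp
  set κ := min ρ (r / 2) with hκ
  have hκ0 : 0 < κ := lt_min hρ (by linarith)
  obtain ⟨J, hJ⟩ := exists_integral_tail_eq (n := d + 1) (q := p) hκ0
    (by push_cast; linarith)
  refine ⟨C * |J|, by positivity, fun ε hε hεr a ha h0 => ?_⟩
  obtain ⟨hJi, hJe⟩ := hJ ε hε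
  set Ψ : EuclideanSpace ℝ (Fin d) × ℝ → EuclideanSpace ℝ (Fin (d + 1)) :=
    fun q => snocPt q.1 q.2 with hΨ
  set f := fun z => P z * tauE E (a • eN d + ε • z) with hf
  have hfle : ∀ z, ‖f z‖ ≤ P z := fun z => by
    rw [hf, norm_mul, norm_of_nonneg (hP.pos z).le]
    exact mul_le_of_le_one_right (hP.pos z).le (abs_tauE_le _ _)
  have hfi : Integrable f := by
    refine (hP.integrable (by linarith)).mono' ?_ (Filter.Eventually.of_forall hfle)
    refine hP.continuous.aestronglyMeasurable.mul
      ((measurable_tauE hE).comp ?_).aestronglyMeasurable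
    fun_prop
  have hgi : Integrable (f ∘ Ψ) (volume.prod volume) :=
    ((measurePreserving_snocPt d).integrable_comp_emb (measurableEmbedding_snocPt d)).2 hfi
  set S : Set (EuclideanSpace ℝ (Fin d) × ℝ) :=
    ball 0 (ρ / ε) ×ˢ Ioo (-(r / 2 / ε)) (r / 2 / ε) with hS
  have hSm : MeasurableSet S := measurableSet_ball.prod measurableSet_Ioo
  have hsum := integral_add_compl hSm hgi
  have hcv : ∀ g : EuclideanSpace ℝ (Fin (d + 1)) → ℝ,
      ∫ q, g (Ψ q) ∂(volume.prod volume) = ∫ z, g z :=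
    (measurePreserving_snocPt d).integral_comp (measurableEmbedding_snocPt d)
  replace hsum := hsum.trans ((hcv f).trans h0)
  have htail : |∫ q in Sᶜ, (f ∘ Ψ) q ∂(volume.prod volume)| ≤ C * |J| * ε ^ (2 * s) := by
    set k := {z : EuclideanSpace ℝ (Fin (d + 1)) | κ ≤ ε * ‖z‖}.indicator
      (fun z => ‖z‖ ^ (-p)) with hk
    have hki : Integrable (fun q => C * k (Ψ q)) (volume.prod volume) :=
      (((measurePreserving_snocPt d).integrable_comp_emb
        (measurableEmbedding_snocPt d)).2 hJi).const_mul C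
    rw [← integral_indicator hSm.compl, ← norm_eq_abs]
    refine (norm_integral_le_of_norm_le hki (Filter.Eventually.of_forall fun q => ?_)).trans ?_
    · by_cases hq : q ∈ S
      · rw [indicator_of_notMem (by simpa using hq), norm_zero, hk]
        refine mul_nonneg hC.le (indicator_nonneg (fun z _ => by positivity) _)
      · rw [indicator_of_mem (by simpa using hq)]
        have hq' : κ ≤ ε * ‖Ψ q‖ := by
          simp only [hS, mem_prod, mem_ball, dist_zero_right, mem_Ioo, ← abs_lt] at hq
          by_cases h1 : ‖q.1‖ < ρ / ε
          · have h2 : r / 2 / ε ≤ |q.2| := not_lt.1 fun h => hq ⟨h1, h⟩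
            rw [div_le_iff₀' hε] at h2
            exact (min_le_right _ _).trans (h2.trans (by
              have := abs_le_norm_snocPt q.1 q.2
              gcongr))
          · have h2 := not_lt.1 h1
            rw [div_le_iff₀' hε] at h2
            exact (min_le_left _ _).trans (h2.trans (by
              have := norm_le_norm_snocPt q.1 q.2
              gcongr))
        rw [hk, indicator_of_mem (by exact hq')]
        refine (hfle _).trans ((hP.upper _).trans ?_)
        have hpos : 0 < ‖Ψ q‖ := by
          by_contra! h
          nlinarith
        rw [rpow_neg hpos.le, ← one_div]
        have : 0 < ‖Ψ q‖ ^ p := by positivity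
        gcongr
        linarith
    · rw [integral_const_mul, hcv k, hJe, mul_assoc C]
      have : p - ((d + 1 : ℕ) : ℝ) = 2 * s := by push_cast; ring
      rw [this]
      gcongr
      exact le_abs_self J
  have hgS : IntegrableOn (f ∘ Ψ) S (volume.prod volume) := hgi.integrableOn
  have hinner : ∀ z ∈ ball (0 : EuclideanSpace ℝ (Fin d)) (ρ / ε),
      ∫ w in Ioo (-(r / 2 / ε)) (r / 2 / ε), (f ∘ Ψ) (z, w)
        = -2 * ∫ w in 0..(γ (ε • z) - a) / ε, P (snocPt z w) := by
    intro z hz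
    have hz' : ‖ε • z‖ < ρ := by
      rw [mem_ball, dist_zero_right, lt_div_iff₀' hε] at hz
      rwa [norm_smul, norm_of_nonneg hε.le]
    have hγz := hγρ _ hz'
    have hw' : ∀ w, |w| < r / 2 / ε → |a + ε * w| < r := fun w hw => by
      rw [lt_div_iff₀' hε] at hw
      refine (abs_add_le _ _).trans_lt ?_
      rw [abs_mul, abs_of_pos hε]
      linarith
    simp only [Function.comp_apply, hf, hΨ, smul_eN_add_smul_snocPt]
    refine setIntegral_even_mul_sign (hP.continuous_slice z)
      (fun w => hP.radial _ _ (norm_snocPt_neg z w)) ?_ ?_ ?_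
    · rw [abs_div, abs_of_pos hε]
      gcongr
      exact (abs_sub _ _).trans (by linarith)
    · intro w hw hlt
      rw [div_lt_iff₀' hε] at hlt
      exact tauE_of_lt hEQ (hz'.trans_le hρr) (hw' w hw) (by linarith)
    · intro w hw hlt
      rw [lt_div_iff₀' hε] at hlt
      exact tauE_of_gt hγ hEQ (hz'.trans_le hρr) (hw' w hw) (by linarith)
  have hInt : IntegrableOn (fun z => ∫ w in Ioo (-(r / 2 / ε)) (r / 2 / ε), (f ∘ Ψ) (z, w))
      (ball 0 (ρ / ε)) := by
    rw [IntegrableOn, hS, ← Measure.prod_restrict] at hgS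
    exact hgS.integral_prod_left
  have hF : IntegrableOn (fun z => -2 * ∫ w in 0..(γ (ε • z) - a) / ε, P (snocPt z w))
      (ball 0 (ρ / ε)) := hInt.congr_fun hinner measurableSet_ball
  refine ⟨?_, ?_⟩
  · refine (Integrable.const_mul hF (-1 / 2)).congr (Filter.Eventually.of_forall fun z => ?_)
    simp only
    ring
  · rw [setIntegral_prod _ hgS, setIntegral_congr_fun measurableSet_ball hinner,
      integral_const_mul] at hsum
    rw [abs_le] at htail ⊢
    have h2 : 0 ≤ C * |J| * ε ^ (2 * s) := by positivity
    constructor <;> linarith [htail.1, htail.2]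

/-! ### One-dimensional estimates on slices -/

lemma exists_sign_mul_integral_add_le (h : ℝ) : ∃ σ : ℝ, |σ| = 1 ∧
    ∀ (f : ℝ → ℝ) (m M c : ℝ), Continuous f → |h| ≤ 1 → (∀ w, |w| ≤ 1 → m ≤ f w) →
      (∀ w, |f w| ≤ M) → |h| * m ≤ σ * (∫ w in 0..c - h, f w) + M * |c| := by
  have key : ∀ (f : ℝ → ℝ) (M c : ℝ), Continuous f → (∀ w, |f w| ≤ M) →
      |(∫ w in 0..c - h, f w) + ∫ w in (-h)..0, f w| ≤ M * |c| := by
    intro f M c hf hM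
    have h1 := intervalIntegral.integral_add_adjacent_intervals
      (hf.intervalIntegrable (μ := volume) (-h) 0) (hf.intervalIntegrable 0 (c - h))
    have h2 := intervalIntegral.norm_integral_le_of_norm_le_const
      (a := -h) (b := c - h) (f := f) (C := M) (fun w _ => hM w)
    rw [add_comm, h1]
    simpa using h2
  rcases le_total 0 h with hh | hh
  · refine ⟨-1, by simp, fun f m M c hf h1 hm hM => ?_⟩
    rw [abs_of_nonneg hh] at h1 ⊢
    have h3 := (abs_le.1 (key f M c hf hM)).2
    have h4 : ∫ w in (-h)..0, m ≤ ∫ w in (-h)..0, f w :=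
      intervalIntegral.integral_mono_on (by linarith) (by simp) (hf.intervalIntegrable _ _)
        fun w hw => hm w (abs_le.2 ⟨by linarith [hw.1], by linarith [hw.2]⟩)
    simp only [intervalIntegral.integral_const, smul_eq_mul] at h4
    linarith
  · refine ⟨1, by simp, fun f m M c hf h1 hm hM => ?_⟩
    rw [abs_of_nonpos hh] at h1 ⊢
    have h3 := (abs_le.1 (key f M c hf hM)).1
    have h4 : ∫ w in 0..(-h), m ≤ ∫ w in 0..(-h), f w :=
      intervalIntegral.integral_mono_on (by linarith) (by simp) (hf.intervalIntegrable _ _)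
        fun w hw => hm w (abs_le.2 ⟨by linarith [hw.1], by linarith [hw.2]⟩)
    rw [intervalIntegral.integral_symm 0 (-h)] at h3
    simp only [intervalIntegral.integral_const, smul_eq_mul] at h4
    linarith

lemma abs_integral_sub_mul_le {f : ℝ → ℝ} (hf : Continuous f) {K : ℝ} (hK : 0 ≤ K)
    (hlip : ∀ w, |f w - f 0| ≤ K * |w|) (b β : ℝ) :
    |(∫ w in 0..b, f w) - β * f 0| ≤ |b - β| * |f 0| + K * b ^ 2 := by
  have h1 : ∫ w in 0..b, (f w - f 0) = (∫ w in 0..b, f w) - b * f 0 := by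
    rw [intervalIntegral.integral_sub (hf.intervalIntegrable _ _) (by simp)]
    simp
  have h2 : |∫ w in 0..b, (f w - f 0)| ≤ K * |b| * |b| := by
    have := intervalIntegral.norm_integral_le_of_norm_le_const
      (a := 0) (b := b) (f := fun w => f w - f 0) (C := K * |b|) (fun w hw => by
        refine (hlip w).trans ?_
        have : |w| ≤ |b| := by
          rcases le_total 0 b with hb | hb
          · rw [uIoc_of_le hb] at hw
            rw [abs_of_pos hw.1, abs_of_nonneg hb]; exact hw.2
          · rw [uIoc_of_ge hb] at hw
            rw [abs_of_nonpos hw.2, abs_of_nonpos hb]; linarith [hw.1]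
        gcongr)
    simpa using this
  rw [h1] at h2
  have h3 : (∫ w in 0..b, f w) - β * f 0
      = ((∫ w in 0..b, f w) - b * f 0) + (b - β) * f 0 := by ring
  rw [h3]
  refine (abs_add_le _ _).trans ?_
  rw [abs_mul, add_comm, ← sq_abs b]
  linarith

lemma pow_div_one_add_rpow_le {x p : ℝ} (hx : 0 ≤ x) {k : ℕ} (hk : k ≠ 0) :
    x ^ k * (1 / (1 + x ^ p)) ≤ x ^ (-(p - k)) := by
  rcases hx.eq_or_lt with rfl | hx
  · rw [zero_pow hk, zero_mul]; positivity
  · rw [neg_sub, rpow_sub hx, rpow_natCast, mul_one_div]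
    have : 0 < x ^ p := by positivity
    gcongr
    linarith

lemma one_div_one_add_rpow_add_one_le {x p : ℝ} (hx : 0 ≤ x) (hp : 0 ≤ p) :
    1 / (1 + x ^ (p + 1)) ≤ 2 * (1 / (1 + x ^ p)) := by
  rw [mul_one_div, div_le_div_iff₀ (by positivity) (by positivity)]
  have h0 : 0 ≤ x ^ (p + 1) := by positivity
  rcases le_total x 1 with h | h
  · have : x ^ p ≤ 1 := rpow_le_one hx h hp
    linarith
  · have : x ^ p ≤ x ^ (p + 1) := rpow_le_rpow_of_exponent_le h (by linarith)
    linarith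

/-! ### Consequences of the slab identity -/

section Velocity

variable {d : ℕ} {s C : ℝ} {P : EuclideanSpace ℝ (Fin (d + 1)) → ℝ}
  {γ : EuclideanSpace ℝ (Fin d) → ℝ} {ρ K : ℝ}
  {B : EuclideanSpace ℝ (Fin d) →L[ℝ] EuclideanSpace ℝ (Fin d) →L[ℝ] ℝ}

lemma abs_apply_apply_le (z : EuclideanSpace ℝ (Fin d)) : |B z z| ≤ ‖B‖ * ‖z‖ ^ 2 := by
  have := B.le_opNorm₂ z z
  rw [norm_eq_abs] at this
  linarith

/-- A zero of the rescaled solution at height `v * ε ^ 2` has bounded velocity `v`. -/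
lemma exists_velocity_bound (hs : 1 / 2 < s) (hP : KernelBounds d (d + 1 + 2 * s) C P)
    (hρ : 0 < ρ) (hρ1 : ρ ≤ 1) (hK : 0 ≤ K)
    (hγ : ∀ y, ‖y‖ < ρ → |γ y - 1 / 2 * B y y| ≤ K * ‖y‖ ^ 3) {C₀ : ℝ} (hC₀ : 0 ≤ C₀) :
    ∃ V : ℝ, 0 ≤ V ∧ ∀ ε : ℝ, 0 < ε → ε ≤ 1 → ∀ v : ℝ, |v * ε| ≤ 1 →
      IntegrableOn (fun z => ∫ w in 0..(γ (ε • z) - v * ε ^ 2) / ε, P (snocPt z w))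
        (ball 0 (ρ / ε)) →
      |∫ z in ball 0 (ρ / ε), ∫ w in 0..(γ (ε • z) - v * ε ^ 2) / ε, P (snocPt z w)|
        ≤ C₀ * ε ^ (2 * s) →
      |v| ≤ V := by
  have hC := hP.const_pos
  have hd0 : (0:ℝ) ≤ d := Nat.cast_nonneg d
  set p : ℝ := d + 1 + 2 * s with hp
  have hp0 : 0 ≤ p := by linarith
  set m : ℝ := C⁻¹ / (1 + 2 ^ p) with hm
  have hm0 : 0 < m := by positivity
  set I : ℝ := ∫ z : EuclideanSpace ℝ (Fin d), ‖z‖ ^ 2 * (1 / (1 + ‖z‖ ^ p)) with hI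
  have hIi := integrable_norm_sq_div_one_add_norm_rpow (n := d) (p := p) (by linarith)
  have hI0 : 0 ≤ I := integral_nonneg fun z => by positivity
  set β : ℝ := volume.real (ball (0 : EuclideanSpace ℝ (Fin d)) ρ) with hβ
  have hβ0 : 0 < β := by
    rw [hβ, measureReal_def]
    exact ENNReal.toReal_pos (measure_ball_pos _ _ hρ).ne' measure_ball_lt_top.ne
  set Q : ℝ := ‖B‖ / 2 + K with hQ
  refine ⟨(C₀ + C * Q * I) / (m * β), by positivity, fun ε hε hε1 v hv hFi hF => ?_⟩
  set F := fun z => ∫ w in 0..(γ (ε • z) - v * ε ^ 2) / ε, P (snocPt z w) with hFdef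
  obtain ⟨σ, hσ1, hσ⟩ := exists_sign_mul_integral_add_le (v * ε)
  have hpt : ∀ z ∈ ball (0 : EuclideanSpace ℝ (Fin d)) (ρ / ε),
      (ball 0 ρ).indicator (fun _ => |v * ε| * m) z
        ≤ σ * F z + C * Q * ε * (‖z‖ ^ 2 * (1 / (1 + ‖z‖ ^ p))) := by
    intro z hz
    rw [mem_ball, dist_zero_right, lt_div_iff₀' hε] at hz
    have hnz : ‖ε • z‖ = ε * ‖z‖ := by rw [norm_smul, norm_of_nonneg hε.le]
    have hγz := hγ (ε • z) (by rwa [hnz])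
    have hB := abs_apply_apply_le (B := B) (ε • z)
    rw [hnz] at hγz hB
    have hc : |γ (ε • z) / ε| ≤ Q * ε * ‖z‖ ^ 2 := by
      rw [abs_div, abs_of_pos hε, div_le_iff₀ hε]
      have h3 : |γ (ε • z)| ≤ K * (ε * ‖z‖) ^ 3 + 1 / 2 * (‖B‖ * (ε * ‖z‖) ^ 2) := by
        have h4 : γ (ε • z) = (γ (ε • z) - 1 / 2 * B (ε • z) (ε • z))
          + 1 / 2 * B (ε • z) (ε • z) := by ring
        rw [h4]
        refine (abs_add_le _ _).trans (add_le_add hγz ?_)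
        rw [abs_mul, abs_of_pos (by norm_num : (0:ℝ) < 1 / 2)]
        gcongr
      have h5 : (ε * ‖z‖) ^ 3 ≤ (ε * ‖z‖) ^ 2 :=
        pow_le_pow_of_le_one (by positivity) (by linarith) (by norm_num)
      have h6 := mul_le_mul_of_nonneg_left h5 hK
      rw [hQ]
      nlinarith
    have hslice : ∀ w, |P (snocPt z w)| ≤ C * (1 / (1 + ‖z‖ ^ p)) := fun w => by
      rw [abs_of_pos (hP.pos _)]; exact hP.upper_slice hp0 z w
    have hsplit : (γ (ε • z) - v * ε ^ 2) / ε = γ (ε • z) / ε - v * ε := by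
      field_simp
    have hmass : ∀ μ, (∀ w, |w| ≤ 1 → μ ≤ P (snocPt z w)) → |v * ε| * μ
        ≤ σ * F z + C * Q * ε * (‖z‖ ^ 2 * (1 / (1 + ‖z‖ ^ p))) := by
      intro μ hμ
      have := hσ (fun w => P (snocPt z w)) μ _ (γ (ε • z) / ε) (hP.continuous_slice z) hv hμ
        hslice
      rw [← hsplit] at this
      refine this.trans ?_
      have h7 := mul_le_mul_of_nonneg_left hc
        (by positivity : 0 ≤ C * (1 / (1 + ‖z‖ ^ p)))
      simp only [hFdef]
      linarith
    by_cases hzρ : z ∈ ball (0 : EuclideanSpace ℝ (Fin d)) ρ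
    · rw [indicator_of_mem hzρ]
      refine hmass m fun w hw => le_trans ?_ (hP.lower _)
      rw [mem_ball, dist_zero_right] at hzρ
      have := norm_snocPt_le z w
      rw [hm]
      gcongr
      linarith
    · rw [indicator_of_notMem hzρ]
      simpa using hmass 0 fun w _ => (hP.pos _).le
  have hsub : ball (0 : EuclideanSpace ℝ (Fin d)) ρ ⊆ ball 0 (ρ / ε) :=
    ball_subset_ball (by rw [le_div_iff₀ hε]; nlinarith)
  have hmono := setIntegral_mono_on
    (((integrable_indicator_iff measurableSet_ball).2
      (integrableOn_const measure_ball_lt_top.ne)).integrableOn)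
    ((Integrable.const_mul hFi σ).add ((hIi.const_mul (C * Q * ε)).integrableOn))
    measurableSet_ball hpt
  simp only [Pi.add_apply] at hmono
  rw [setIntegral_indicator measurableSet_ball, inter_eq_self_of_subset_right hsub,
    setIntegral_const, smul_eq_mul, integral_add (Integrable.const_mul hFi σ)
      ((hIi.const_mul (C * Q * ε)).integrableOn), integral_const_mul, integral_const_mul]
    at hmono
  have h1 : σ * ∫ z in ball 0 (ρ / ε), F z ≤ C₀ * ε ^ (2 * s) := by
    refine (le_abs_self _).trans ?_
    rw [abs_mul, hσ1, one_mul]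
    exact hF
  have h2 : ∫ z in ball (0 : EuclideanSpace ℝ (Fin d)) (ρ / ε),
      ‖z‖ ^ 2 * (1 / (1 + ‖z‖ ^ p)) ≤ I :=
    setIntegral_le_integral hIi (Filter.Eventually.of_forall fun z => by positivity)
  have h3 : ε ^ (2 * s) ≤ ε := by
    simpa using rpow_le_rpow_of_exponent_ge hε hε1 (by linarith : 1 ≤ 2 * s)
  have h4 := mul_le_mul_of_nonneg_left h2 (by positivity : 0 ≤ C * Q * ε)
  have h5 := mul_le_mul_of_nonneg_left h3 hC₀
  rw [abs_mul, abs_of_pos hε] at hmono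
  rw [le_div_iff₀ (by positivity)]
  refine le_of_mul_le_mul_right ?_ hε
  linarith

/-- The slab integral differs from its linearization by `min 1 (ε ‖z‖) ‖z‖ ^ (1 - d - 2 s)`,
up to a factor of order `ε` and an integrable term of order `ε ^ 2`. -/
lemma exists_abs_slab_sub_linearization_le (hs : 0 < s)
    (hP : KernelBounds d (d + 1 + 2 * s) C P)
    (hρ : 0 < ρ) (hρ1 : ρ ≤ 1) (hK : 0 ≤ K)
    (hγ : ∀ y, ‖y‖ < ρ → |γ y - 1 / 2 * B y y| ≤ K * ‖y‖ ^ 3) {V : ℝ} (hV : 0 ≤ V) :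
    ∃ A D : ℝ, 0 ≤ A ∧ 0 ≤ D ∧ ∀ ε : ℝ, 0 < ε → ε ≤ 1 → ∀ v : ℝ, |v| ≤ V → ∀ z,
      |(ball 0 (ρ / ε)).indicator
          (fun z => ∫ w in 0..(γ (ε • z) - v * ε ^ 2) / ε, P (snocPt z w)) z
        - ε * ((1 / 2 * B z z - v) * P (snocPt z 0))|
      ≤ ε * A * (min 1 (ε * ‖z‖) * ‖z‖ ^ (-((d : ℝ) - 1 + 2 * s)))
        + ε ^ 2 * D * (1 / (1 + ‖z‖ ^ ((d : ℝ) + 1 + 2 * s))) := by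
  have hC := hP.const_pos
  have hd0 : (0:ℝ) ≤ d := Nat.cast_nonneg d
  set p : ℝ := d + 1 + 2 * s with hp
  have hp0 : 0 ≤ p := by linarith
  have hq : (d : ℝ) - 1 + 2 * s = p - (2 : ℕ) := by push_cast; linarith
  rw [hq]
  set Q : ℝ := ‖B‖ / 2 + K with hQ
  refine ⟨(K * C + 2 * C * Q ^ 2) + (‖B‖ / 2 + V / ρ ^ 2) * C / ρ, 4 * C * V ^ 2,
    by positivity, by positivity, fun ε hε hε1 v hv z => ?_⟩
  have hz0 := norm_nonneg z
  set X := ‖z‖ with hX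
  set Y := X ^ (-(p - (2 : ℕ))) with hY
  have hY0 : 0 ≤ Y := by positivity
  set ω := 1 / (1 + X ^ p) with hω
  have hω0 : 0 ≤ ω := by positivity
  have hXω : X ^ 2 * ω ≤ Y := pow_div_one_add_rpow_le hz0 two_ne_zero
  have hB : |B z z| ≤ ‖B‖ * X ^ 2 := abs_apply_apply_le z
  have hφ : |P (snocPt z 0)| ≤ C * ω := by
    rw [abs_of_pos (hP.pos _)]; exact hP.upper_slice hp0 z 0
  by_cases hz : z ∈ ball (0 : EuclideanSpace ℝ (Fin d)) (ρ / ε)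
  · rw [indicator_of_mem hz]
    rw [mem_ball, dist_zero_right, lt_div_iff₀' hε] at hz
    have hnz : ‖ε • z‖ = ε * X := by rw [norm_smul, norm_of_nonneg hε.le]
    have hγz := hγ (ε • z) (by rwa [hnz])
    rw [hnz] at hγz
    set b := (γ (ε • z) - v * ε ^ 2) / ε with hb
    set β := ε * (1 / 2 * B z z - v) with hβ
    have hεX : ε * X ≤ 1 := hz.le.trans hρ1
    have hbβ : |b - β| ≤ K * ε ^ 2 * X ^ 3 := by
      have : b - β = (γ (ε • z) - 1 / 2 * B (ε • z) (ε • z)) / ε := by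
        rw [hb, hβ]
        simp only [map_smul, _root_.smul_apply, smul_eq_mul]
        field_simp
        ring
      rw [this, abs_div, abs_of_pos hε, div_le_iff₀ hε]
      linarith
    have hb2 : b ^ 2 ≤ 2 * ε ^ 2 * (Q ^ 2 * X ^ 4 + V ^ 2) := by
      have h1 : |β| ≤ ε * (‖B‖ / 2 * X ^ 2 + V) := by
        rw [hβ, abs_mul, abs_of_pos hε]
        gcongr
        refine (abs_sub _ _).trans ?_
        rw [abs_mul, abs_of_pos (by norm_num : (0:ℝ) < 1 / 2)]
        linarith
      have h2 : K * ε ^ 2 * X ^ 3 ≤ ε * (K * X ^ 2) := by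
        have : K * ε ^ 2 * X ^ 3 = ε * (K * X ^ 2) * (ε * X) := by ring
        rw [this]
        exact mul_le_of_le_one_right (by positivity) hεX
      have h3 : |b| ≤ ε * (Q * X ^ 2 + V) := by
        have h4 : b = (b - β) + β := by ring
        rw [h4]
        refine (abs_add_le _ _).trans ?_
        rw [hQ]
        linarith
      rw [← sq_abs]
      calc |b| ^ 2 ≤ (ε * (Q * X ^ 2 + V)) ^ 2 := by gcongr
        _ ≤ 2 * ε ^ 2 * (Q ^ 2 * X ^ 4 + V ^ 2) := by
          have : 0 ≤ ε ^ 2 * (Q * X ^ 2 - V) ^ 2 := by positivity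
          linarith
    have hmain := abs_integral_sub_mul_le (hP.continuous_slice z)
      (by positivity : 0 ≤ C / (1 + X ^ (p + 1))) (hP.lipschitz z) b β
    have hmin : min 1 (ε * X) = ε * X := min_eq_right hεX
    rw [hmin, ← mul_assoc ε (1 / 2 * B z z - v)]
    refine hmain.trans ?_
    have t1 : |b - β| * |P (snocPt z 0)| ≤ ε * (K * C) * (ε * X * Y) := by
      calc |b - β| * |P (snocPt z 0)| ≤ (K * ε ^ 2 * X ^ 3) * (C * ω) := by gcongr
        _ = ε * (K * C) * (ε * X * (X ^ 2 * ω)) := by ring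
        _ ≤ _ := by gcongr
    have t2 : C / (1 + X ^ (p + 1)) * b ^ 2
        ≤ ε * (2 * C * Q ^ 2) * (ε * X * Y) + ε ^ 2 * (4 * C * V ^ 2) * ω := by
      have h3 : X ^ 3 * (1 / (1 + X ^ (p + 1))) ≤ Y := by
        have := pow_div_one_add_rpow_le (p := p + 1) hz0 three_ne_zero
        have e : p + 1 - (3 : ℕ) = p - (2 : ℕ) := by push_cast; ring
        rwa [e] at this
      have h4 : 1 / (1 + X ^ (p + 1)) ≤ 2 * ω := one_div_one_add_rpow_add_one_le hz0 hp0
      calc C / (1 + X ^ (p + 1)) * b ^ 2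
          ≤ C / (1 + X ^ (p + 1)) * (2 * ε ^ 2 * (Q ^ 2 * X ^ 4 + V ^ 2)) := by gcongr
        _ = ε * (2 * C * Q ^ 2) * (ε * X * (X ^ 3 * (1 / (1 + X ^ (p + 1)))))
            + ε ^ 2 * (2 * C * V ^ 2) * (1 / (1 + X ^ (p + 1))) := by ring
        _ ≤ ε * (2 * C * Q ^ 2) * (ε * X * Y) + ε ^ 2 * (2 * C * V ^ 2) * (2 * ω) := by
          gcongr
        _ = _ := by ring
    have t3 : 0 ≤ ε * ((‖B‖ / 2 + V / ρ ^ 2) * C / ρ) * (ε * X * Y) := by positivity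
    linarith
  · rw [indicator_of_notMem hz, zero_sub, abs_neg]
    rw [mem_ball, dist_zero_right, not_lt, div_le_iff₀' hε] at hz
    have hXρ : ρ ≤ X := hz.trans (mul_le_of_le_one_left hz0 hε1)
    have hmin : ρ ≤ min 1 (ε * X) := le_min hρ1 hz
    have hV' : V ≤ V / ρ ^ 2 * X ^ 2 := by
      rw [div_mul_eq_mul_div, le_div_iff₀ (by positivity)]
      gcongr
    have h1 : |1 / 2 * B z z - v| ≤ (‖B‖ / 2 + V / ρ ^ 2) * X ^ 2 := by
      refine (abs_sub _ _).trans ?_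
      rw [abs_mul, abs_of_pos (by norm_num : (0:ℝ) < 1 / 2)]
      linarith
    have hYW : Y ≤ min 1 (ε * X) * Y / ρ := by
      rw [le_div_iff₀ hρ, mul_comm]
      gcongr
    have h2 : |ε * ((1 / 2 * B z z - v) * P (snocPt z 0))|
        ≤ ε * ((‖B‖ / 2 + V / ρ ^ 2) * C / ρ) * (min 1 (ε * X) * Y) := by
      rw [abs_mul, abs_mul, abs_of_pos hε]
      calc ε * (|1 / 2 * B z z - v| * |P (snocPt z 0)|)
          ≤ ε * (((‖B‖ / 2 + V / ρ ^ 2) * X ^ 2) * (C * ω)) := by gcongr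
        _ = ε * ((‖B‖ / 2 + V / ρ ^ 2) * C) * (X ^ 2 * ω) := by ring
        _ ≤ ε * ((‖B‖ / 2 + V / ρ ^ 2) * C) * (min 1 (ε * X) * Y / ρ) := by
          have := hXω.trans hYW
          gcongr
        _ = _ := by ring
    have h3 : 0 ≤ ε * (K * C + 2 * C * Q ^ 2) * (min 1 (ε * X) * Y) := by positivity
    have h4 : 0 ≤ ε ^ 2 * (4 * C * V ^ 2) * ω := by positivity
    linarith

lemma exists_abs_integral_linearization_le [NeZero d] (hs : 1 / 2 < s) (hs1 : s < 1)
    (hP : KernelBounds d (d + 1 + 2 * s) C P)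
    (hρ : 0 < ρ) (hρ1 : ρ ≤ 1) (hK : 0 ≤ K)
    (hγ : ∀ y, ‖y‖ < ρ → |γ y - 1 / 2 * B y y| ≤ K * ‖y‖ ^ 3) {C₀ : ℝ} (hC₀ : 0 ≤ C₀) :
    ∃ C₁ : ℝ, 0 ≤ C₁ ∧ ∀ ε : ℝ, 0 < ε → ε ≤ 1 → ∀ v : ℝ, |v * ε| ≤ 1 →
      IntegrableOn (fun z => ∫ w in 0..(γ (ε • z) - v * ε ^ 2) / ε, P (snocPt z w))
        (ball 0 (ρ / ε)) →
      |∫ z in ball 0 (ρ / ε), ∫ w in 0..(γ (ε • z) - v * ε ^ 2) / ε, P (snocPt z w)|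
        ≤ C₀ * ε ^ (2 * s) →
      |∫ z, (1 / 2 * B z z - v) * P (snocPt z 0)| ≤ C₁ * ε ^ (2 * s - 1) := by
  have hd0 : (0:ℝ) ≤ d := Nat.cast_nonneg d
  have hm : AEStronglyMeasurable (fun z => P (snocPt z 0)) :=
    hP.continuous_slice_zero.aestronglyMeasurable
  have hlin : ∀ v : ℝ, Integrable fun z => (1 / 2 * B z z - v) * P (snocPt z 0) := by
    intro v
    have h1 : Integrable fun z => B z z * P (snocPt z 0) := by
      refine ((hP.integrable_norm_sq_mul_slice_zero (by linarith)).const_mul ‖B‖).mono'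
        ((Continuous.aestronglyMeasurable (by fun_prop)).mul hm)
        (Filter.Eventually.of_forall fun z => ?_)
      rw [norm_mul, norm_eq_abs, norm_of_nonneg (hP.pos _).le, ← mul_assoc]
      exact mul_le_mul_of_nonneg_right (abs_apply_apply_le z) (hP.pos _).le
    refine ((h1.const_mul (1 / 2)).sub
      ((hP.integrable_slice_zero (by linarith)).const_mul v)).congr
      (Filter.Eventually.of_forall fun z => ?_)
    simp only [Pi.sub_apply]
    ring
  obtain ⟨V, hV, hVb⟩ := exists_velocity_bound hs hP hρ hρ1 hK hγ hC₀
  obtain ⟨A, D, hA, hD, hAD⟩ :=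
    exists_abs_slab_sub_linearization_le (by linarith) hP hρ hρ1 hK hγ hV
  obtain ⟨J, hJ⟩ := exists_integral_min_eq (n := d) (q := (d : ℝ) - 1 + 2 * s)
    (by linarith) (by linarith)
  have hωi := integrable_one_div_one_add_norm_rpow (n := d) (p := d + 1 + 2 * s) (by linarith)
  set I := ∫ z : EuclideanSpace ℝ (Fin d), 1 / (1 + ‖z‖ ^ ((d : ℝ) + 1 + 2 * s)) with hI
  have hI0 : 0 ≤ I := integral_nonneg fun z => by positivity
  refine ⟨C₀ + A * |J| + D * I, by positivity, fun ε hε hε1 v hv hFi hF => ?_⟩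
  obtain ⟨hJi, hJe⟩ := hJ ε hε
  have hvV := hVb ε hε hε1 v hv hFi hF
  set F := fun z => ∫ w in 0..(γ (ε • z) - v * ε ^ 2) / ε, P (snocPt z w) with hFdef
  have hbound := norm_integral_le_of_norm_le
    (f := fun z => (ball 0 (ρ / ε)).indicator F z - ε * ((1 / 2 * B z z - v) * P (snocPt z 0)))
    ((hJi.const_mul (ε * A)).add (hωi.const_mul (ε ^ 2 * D)))
    (Filter.Eventually.of_forall fun z => hAD ε hε hε1 v hvV z)
  simp only [Pi.add_apply] at hbound
  rw [integral_sub ((integrable_indicator_iff measurableSet_ball).2 hFi)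
    ((hlin v).const_mul ε), integral_indicator measurableSet_ball, integral_const_mul,
    integral_add (hJi.const_mul (ε * A)) (hωi.const_mul (ε ^ 2 * D)), integral_const_mul,
    integral_const_mul, hJe, norm_eq_abs] at hbound
  have hexp : (d : ℝ) - 1 + 2 * s - d = 2 * s - 1 := by ring
  rw [hexp] at hbound
  set T := ∫ z, (1 / 2 * B z z - v) * P (snocPt z 0) with hT
  set G := ∫ z in ball 0 (ρ / ε), F z with hG
  have e1 : ε ^ (2 * s) = ε * ε ^ (2 * s - 1) := by
    have h := rpow_add_one hε.ne' (2 * s - 1)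
    rwa [sub_add_cancel, mul_comm (ε ^ _)] at h
  have e2 : ε ≤ ε ^ (2 * s - 1) := by
    simpa using rpow_le_rpow_of_exponent_ge hε hε1 (by linarith : 2 * s - 1 ≤ 1)
  have h1 : ε * |T| ≤ |G| + |G - ε * T| := by
    have : ε * T = G - (G - ε * T) := by ring
    rw [← abs_of_pos hε, ← abs_mul, abs_of_pos hε]
    calc |ε * T| = |G - (G - ε * T)| := by rw [← this]
      _ ≤ _ := abs_sub _ _
  have h2 : ε * A * (J * ε ^ (2 * s - 1)) ≤ ε * A * (|J| * ε ^ (2 * s - 1)) := by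
    gcongr
    exact le_abs_self J
  have h3 : ε ^ 2 * D * I ≤ ε * (D * I) * ε ^ (2 * s - 1) := by
    have : ε ^ 2 * D * I = ε * (D * I) * ε := by ring
    rw [this]
    gcongr
  rw [e1] at hF
  refine le_of_mul_le_mul_left ?_ hε
  linarith

end Velocity

/-- Proposition 4.1, normal velocity for `s ∈ (1/2,1)`:
`v = c_{N,s} H(0) + O(t^{(2s−1)/2})` with `H(0) = Δγ(0)/(N−1)`. -/
theorem stmt13
    (d : ℕ) (hd : 1 ≤ d) (s : ℝ) (hs : s ∈ Set.Ioo (0 : ℝ) 1)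
    (P : EuclideanSpace ℝ (Fin (d + 1)) → ℝ)
    (hPrad : ∀ x y, ‖x‖ = ‖y‖ → P x = P y)
    (hP1 : ContDiff ℝ 1 P)
    (𝒞 : ℝ) (h𝒞 : 1 ≤ 𝒞)
    (hPlow : ∀ y, 𝒞⁻¹ / (1 + ‖y‖ ^ ((d : ℝ) + 1 + 2 * s)) ≤ P y)
    (hPup : ∀ y, P y ≤ 𝒞 / (1 + ‖y‖ ^ ((d : ℝ) + 1 + 2 * s)))
    (hPgrad : ∀ y, ‖fderiv ℝ P y‖ ≤ 𝒞 / (1 + ‖y‖ ^ ((d : ℝ) + 1 + 2 * s + 1)))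
    (E : Set (EuclideanSpace ℝ (Fin (d + 1))))
    (hEopen : IsOpen E) (hEbdd : Bornology.IsBounded E)
    (h0E : (0 : EuclideanSpace ℝ (Fin (d + 1))) ∈ frontier E)
    (r : ℝ) (hr : 0 < r)
    (γ : EuclideanSpace ℝ (Fin d) → ℝ)
    (hγ3 : ContDiffOn ℝ 3 γ (ball 0 r))
    (hγ0 : γ 0 = 0)
    (hdγ0 : fderivWithin ℝ γ (ball 0 r) 0 = 0)
    (m : ℝ) (hm : m < r)
    (hγm : ∀ y' ∈ ball (0 : EuclideanSpace ℝ (Fin d)) r, |γ y'| ≤ m)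
    (hEQ : ∀ (y' : EuclideanSpace ℝ (Fin d)) (a : ℝ), ‖y'‖ < r → |a| < r →
      (snocPt y' a ∈ E ↔ γ y' < a))
    (hs12 : 1 / 2 < s) :
    ∃ C > (0 : ℝ), ∃ t₀ > (0 : ℝ), ∀ t ∈ Set.Ioo (0 : ℝ) t₀, ∀ v : ℝ,
      |v * t| ≤ t ^ ((1 : ℝ) / 2) →
      uF s P E ((v * t) • eN d) (t ^ s) = 0 →
      |v - ((∫ y' : EuclideanSpace ℝ (Fin d), ‖y'‖ ^ 2 * P (snocPt y' 0)) /
            (2 * ∫ y' : EuclideanSpace ℝ (Fin d), P (snocPt y' 0))) * (lap0 γ / d)| ≤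
        C * t ^ ((2 * s - 1) / 2) := by
  have : NeZero d := ⟨by omega⟩
  have hd0 : (0:ℝ) ≤ d := Nat.cast_nonneg d
  have hs0 := hs.1
  have hP : KernelBounds d (d + 1 + 2 * s) 𝒞 P :=
    KernelBounds.of_fderiv_le (by linarith) hPrad hP1 h𝒞 hPlow hPup hPgrad
  obtain ⟨ρ₀, hρ₀, hρ₀r, K, hK, hγK⟩ := exists_taylor_bound hr hγ3 hγ0 hdγ0
  set B := fderiv ℝ (fderiv ℝ γ) 0 with hB
  have hcont : ContinuousOn γ (ball 0 r) := hγ3.continuousOn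
  obtain ⟨ρ₁, hρ₁, hγρ₁⟩ : ∃ ρ₁ > 0, ∀ y, ‖y‖ < ρ₁ → |γ y| ≤ r / 4 := by
    have h := hcont.continuousAt (isOpen_ball.mem_nhds (mem_ball_self hr))
    obtain ⟨δ, hδ, H⟩ := Metric.continuousAt_iff.1 h (r / 4) (by positivity)
    refine ⟨δ, hδ, fun y hy => ?_⟩
    have := H (by simpa using hy)
    rw [hγ0, dist_zero_right] at this
    exact this.le
  obtain ⟨ρ, hρ, hρle⟩ : ∃ ρ > 0, ρ ≤ ρ₀ ∧ ρ ≤ ρ₁ ∧ ρ ≤ 1 :=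
    ⟨min ρ₀ (min ρ₁ 1), by positivity, min_le_left _ _,
      (min_le_right _ _).trans (min_le_left _ _), (min_le_right _ _).trans (min_le_right _ _)⟩
  obtain ⟨hρρ₀, hρρ₁, hρ1⟩ := hρle
  have hγK' : ∀ y, ‖y‖ < ρ → |γ y - 1 / 2 * B y y| ≤ K * ‖y‖ ^ 3 := fun y hy =>
    hγK y (hy.trans_le hρρ₀)
  obtain ⟨C₀, hC₀, hslab⟩ := exists_abs_integral_slab_le hs0 hP hEopen hr hρ
    (hρρ₀.trans hρ₀r.le) hcont (fun y hy => hγρ₁ y (hy.trans_le hρρ₁)) hEQ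
  obtain ⟨C₁, hC₁, hlin⟩ := exists_abs_integral_linearization_le hs12 hs.2 hP hρ hρ1 hK
    hγK' hC₀
  set φ := fun z : EuclideanSpace ℝ (Fin d) => P (snocPt z 0) with hφ
  have hφrad : ∀ x y, ‖x‖ = ‖y‖ → φ x = φ y := fun x y hxy =>
    hPrad _ _ (by rw [norm_snocPt_zero, norm_snocPt_zero, hxy])
  have hφi := hP.integrable_slice_zero (by linarith)
  have hφ2 := hP.integrable_norm_sq_mul_slice_zero (by linarith)
  have hφm : AEStronglyMeasurable φ := hP.continuous_slice_zero.aestronglyMeasurable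
  have hI := hP.integral_slice_zero_pos (by linarith)
  set I := ∫ z, P (snocPt z 0) with hIdef
  set M := ∫ z : EuclideanSpace ℝ (Fin d), ‖z‖ ^ 2 * P (snocPt z 0) with hM
  have hBint : Integrable fun z => B z z * φ z := by
    refine (hφ2.const_mul ‖B‖).mono'
      ((Continuous.aestronglyMeasurable (by fun_prop)).mul hφm)
      (Filter.Eventually.of_forall fun z => ?_)
    rw [norm_mul, norm_eq_abs, norm_of_nonneg (hP.pos _).le, ← mul_assoc]
    exact mul_le_mul_of_nonneg_right (abs_apply_apply_le z) (hP.pos _).le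
  have hlap : lap0 γ = ∑ i, B (EuclideanSpace.single i 1) (EuclideanSpace.single i 1) := by
    simp [lap0, iteratedFDeriv_two_apply, hB]
  have hquad : ∫ z, B z z * φ z = lap0 γ / d * M := by
    rw [hlap]
    exact integral_quadratic_mul_radial hd hφrad hφm hφ2 B
  have hval : ∀ v : ℝ, ∫ z, (1 / 2 * B z z - v) * P (snocPt z 0)
      = 1 / 2 * (lap0 γ / d * M) - v * I := by
    intro v
    rw [← hquad, ← integral_const_mul, hIdef, ← integral_const_mul,
      ← integral_sub (hBint.const_mul _) (hφi.const_mul _)]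
    refine integral_congr_ae (Filter.Eventually.of_forall fun z => ?_)
    simp only [hφ]
    ring
  refine ⟨C₁ / I + 1, by positivity, min 1 ((r / 4) ^ 2), by positivity, fun t ht v hvt hu => ?_⟩
  have ht0 := ht.1
  obtain ⟨ht1, htr⟩ := lt_min_iff.1 ht.2
  set ε := t ^ ((1 : ℝ) / 2) with hε
  have hε0 : 0 < ε := by positivity
  have hεt : ε ^ 2 = t := by
    rw [hε, ← rpow_natCast, ← rpow_mul ht0.le]; norm_num
  have hε1 : ε ≤ 1 := by
    by_contra! h
    nlinarith
  have hεr : ε ≤ r / 4 := by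
    refine abs_le_of_sq_le_sq' ?_ (by positivity) |>.2
    rw [hεt]; exact htr.le
  rw [← hεt, uF_eq_integral_rescaled hs0 hPrad E _ hε0] at hu
  rw [← hεt] at hvt
  obtain ⟨hFi, hF⟩ := hslab ε hε0 hεr (v * ε ^ 2) hvt hu
  have hvε : |v * ε| ≤ 1 := by
    rw [pow_two, ← mul_assoc, abs_mul, abs_of_pos hε0] at hvt
    exact le_of_mul_le_mul_right (by linarith) hε0
  have hfin := hlin ε hε0 hε1 v hvε hFi hF
  rw [hval] at hfin
  have hpow : ε ^ (2 * s - 1) = t ^ ((2 * s - 1) / 2) := by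
    rw [hε, ← rpow_mul ht0.le]; congr 1; ring
  rw [hpow] at hfin
  have heq : v - M / (2 * I) * (lap0 γ / d) = -((1 / 2 * (lap0 γ / d * M) - v * I) / I) := by
    field_simp
    ring
  rw [heq, abs_neg, abs_div, abs_of_pos hI]
  calc |1 / 2 * (lap0 γ / d * M) - v * I| / I ≤ C₁ * t ^ ((2 * s - 1) / 2) / I := by gcongr
    _ = C₁ / I * t ^ ((2 * s - 1) / 2) := by ring
    _ ≤ (C₁ / I + 1) * t ^ ((2 * s - 1) / 2) := by gcongr; linarith
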